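/- arXiv:2601.17490 — 3 statements merged into one kernel-verified Lean document; each statement's English description precedes it below -/
import Mathlib

section
/- Let E be a nonempty complete metric space, ι a nonempty finite index set, f : ι → E → E a family of maps such that each f i is Lipschitz with constant r i, and suppose r := max over i of r i satisfies r < 1. Then there exists a unique nonempty compact set K ⊆ E with K = ⋃_{i ∈ ι} (f i) '' K. -/
open scoped NNReal

open Metric TopologicalSpace
open scoped ENNReal

section Hausdorff

variable {α β : Type*} [PseudoEMetricSpace α] [PseudoEMetricSpace β] {K : ℝ≥0} {f : α → β}

theorem LipschitzWith.infEDist_image_le (hf : LipschitzWith K f) (x : α) {t : Set α}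
    (ht : t.Nonempty) : infEDist (f x) (f '' t) ≤ K * infEDist x t := by
  have : Nonempty t := ht.to_subtype
  rw [infEDist, infEDist, iInf_image, iInf_subtype', iInf_subtype',
    ENNReal.mul_iInf' (fun h => absurd h ENNReal.coe_ne_top) (fun _ => this)]
  exact iInf_mono fun y => hf x y

theorem LipschitzWith.hausdorffEDist_image_le (hf : LipschitzWith K f) {s t : Set α}
    (hs : s.Nonempty) (ht : t.Nonempty) :
    hausdorffEDist (f '' s) (f '' t) ≤ K * hausdorffEDist s t := by
  apply hausdorffEDist_le_of_infEDist
  · rintro _ ⟨x, hx, rfl⟩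
    refine (hf.infEDist_image_le x ht).trans ?_
    gcongr
    exact infEDist_le_hausdorffEDist_of_mem hx
  · rintro _ ⟨x, hx, rfl⟩
    refine (hf.infEDist_image_le x hs).trans ?_
    gcongr
    rw [hausdorffEDist_comm]
    exact infEDist_le_hausdorffEDist_of_mem hx

end Hausdorff

/-- The Hutchinson operator of a finite family of continuous maps, acting on the nonempty compact
subsets. -/
def hutchinsonOperator {E ι : Type*} [TopologicalSpace E] [Finite ι] [Nonempty ι]
    (f : ι → E → E) (hf : ∀ i, Continuous (f i)) (K : NonemptyCompacts E) :
    NonemptyCompacts E where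
  carrier := ⋃ i, f i '' K
  isCompact' := isCompact_iUnion fun i => K.isCompact.image (hf i)
  nonempty' := Set.nonempty_iUnion.2 ⟨Classical.arbitrary ι, K.nonempty.image _⟩

theorem lipschitzWith_hutchinsonOperator {E ι : Type*} [MetricSpace E] [Finite ι] [Nonempty ι]
    {f : ι → E → E} {c : ℝ≥0} (hf : ∀ i, LipschitzWith c (f i)) :
    LipschitzWith c (hutchinsonOperator f fun i => (hf i).continuous) := fun K L =>
  hausdorffEDist_iUnion_le.trans <| iSup_le fun i =>
    (hf i).hausdorffEDist_image_le K.nonempty L.nonempty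

/-- **Existence and uniqueness of the attractor of a contractive IFS.**
Let `E` be a nonempty complete metric space, `ι` a nonempty finite index set
and `f i : E → E` Lipschitz with constant `r i`, with `r := max_i r i < 1`.
Then there is a unique nonempty compact set `K ⊆ E` with
`K = ⋃ i, f i '' K`. -/
theorem ifs_attractor_exists_unique
    {E : Type*} [MetricSpace E] [CompleteSpace E] [Nonempty E]
    {ι : Type*} [Fintype ι] [Nonempty ι]
    (f : ι → E → E) (r : ι → ℝ≥0) (hf : ∀ i, LipschitzWith (r i) (f i))
    (hr : (Finset.univ.sup r : ℝ≥0) < 1) :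
    ∃! K : Set E, K.Nonempty ∧ IsCompact K ∧ K = ⋃ i, f i '' K := by
  have hf' : ∀ i, LipschitzWith (Finset.univ.sup r) (f i) := fun i =>
    (hf i).weaken (Finset.le_sup (Finset.mem_univ i))
  have hT : ContractingWith (Finset.univ.sup r)
      (hutchinsonOperator f fun i => (hf' i).continuous) :=
    ⟨hr, lipschitzWith_hutchinsonOperator hf'⟩
  let K := hT.fixedPoint
  refine ⟨K, ⟨K.nonempty, K.isCompact, congrArg SetLike.coe hT.fixedPoint_isFixedPt.symm⟩, ?_⟩
  rintro L ⟨hne, hc, hL⟩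
  exact congrArg SetLike.coe (hT.fixedPoint_unique (x := ⟨⟨L, hc⟩, hne⟩)
    (NonemptyCompacts.ext hL.symm))
end

section
/- Let E be a complete metric space, ι a nonempty finite index set, f : ι → E → E with each f i Lipschitz with constant r i, r := max over i of r i with r < 1, and x₀ ∈ E. Define the depth-k endpoint sets A_k := { (f (w 0) ∘ ⋯ ∘ f (w (k−1)))(x₀) : w : Fin k → ι } for k ∈ ℕ. Then the canopy set 𝒞 := closure(⋃_{k ∈ ℕ} A_k) is a compact subset of E. -/
open scoped NNReal

/-- The composition `f (w 0) ∘ f (w 1) ∘ ⋯ ∘ f (w (k-1))` associated with a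
word `w : Fin k → ι` over a family of maps `f i : E → E`. -/
def compWord {E ι : Type*} (f : ι → E → E) : {k : ℕ} → (Fin k → ι) → E → E
  | 0, _ => id
  | _ + 1, w => f (w 0) ∘ compWord f (fun j => w j.succ)

theorem dist_compWord_le {E ι : Type*} [PseudoMetricSpace E] {f : ι → E → E} {R : ℝ≥0}
    (hf : ∀ i, LipschitzWith R (f i)) {x₀ : E} {M : ℝ} (hM : 0 ≤ M)
    (hfM : ∀ i, R * M + dist (f i x₀) x₀ ≤ M) {k : ℕ} (w : Fin k → ι) :
    dist (compWord f w x₀) x₀ ≤ M := by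
  induction k with
  | zero => simpa [compWord] using hM
  | succ k ih =>
    calc dist (f (w 0) (compWord f (fun j => w j.succ) x₀)) x₀
        ≤ dist (f (w 0) (compWord f (fun j => w j.succ) x₀)) (f (w 0) x₀)
          + dist (f (w 0) x₀) x₀ := dist_triangle _ _ _
      _ ≤ R * M + dist (f (w 0) x₀) x₀ := by
          gcongr
          exact ((hf (w 0)).dist_le_mul _ _).trans (by gcongr; exact ih _)
      _ ≤ M := hfM _

/-- A bounded set that is covered by a point and its own images under finitely many uniform
contractions is totally bounded. -/
theorem totallyBounded_of_subset_insert_iUnion_image {E ι : Type*} [PseudoMetricSpace E] [Finite ι]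
    {f : ι → E → E} {R : ℝ≥0} (hR : R < 1) (hf : ∀ i, LipschitzWith R (f i)) {x₀ : E} {M : ℝ}
    {S : Set E} (hSM : S ⊆ Metric.closedBall x₀ M) (hS : S ⊆ insert x₀ (⋃ i, f i '' S)) :
    TotallyBounded S := by
  rcases S.eq_empty_or_nonempty with rfl | ⟨z, hz⟩
  · exact totallyBounded_empty
  have hM : 0 ≤ M := dist_nonneg.trans (Metric.mem_closedBall.mp (hSM hz))
  have cover (n : ℕ) : ∃ t : Set E, t.Finite ∧ ∀ x ∈ S, ∃ y ∈ t, dist x y ≤ R ^ n * M := by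
    induction n with
    | zero => exact ⟨{x₀}, Set.finite_singleton x₀, fun x hx => ⟨x₀, rfl, by simpa using hSM hx⟩⟩
    | succ n ih =>
      obtain ⟨t, ht, hcov⟩ := ih
      refine ⟨insert x₀ (⋃ i, f i '' t),
        (Set.finite_iUnion fun i => ht.image (f i)).insert x₀, fun x hx => ?_⟩
      rcases hS hx with rfl | hx
      · exact ⟨x, Set.mem_insert _ _, by rw [dist_self]; positivity⟩
      · obtain ⟨i, u, hu, rfl⟩ := Set.mem_iUnion.mp hx
        obtain ⟨y, hy, huy⟩ := hcov u hu
        refine ⟨f i y, Or.inr (Set.mem_iUnion.mpr ⟨i, y, hy, rfl⟩), ?_⟩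
        calc dist (f i u) (f i y) ≤ R * dist u y := (hf i).dist_le_mul u y
          _ ≤ R * (R ^ n * M) := by gcongr
          _ = R ^ (n + 1) * M := by ring
  refine Metric.totallyBounded_iff.mpr fun ε hε => ?_
  have hlim : Filter.Tendsto (fun n : ℕ => (R : ℝ) ^ n * M) Filter.atTop (nhds 0) := by
    simpa using (tendsto_pow_atTop_nhds_zero_of_lt_one R.coe_nonneg
      (NNReal.coe_lt_one.mpr hR)).mul_const M
  obtain ⟨n, hn⟩ := (hlim.eventually_lt_const hε).exists
  obtain ⟨t, ht, hcov⟩ := cover n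
  refine ⟨t, ht, fun x hx => ?_⟩
  obtain ⟨y, hy, hxy⟩ := hcov x hx
  exact Set.mem_iUnion₂.mpr ⟨y, hy, hxy.trans_lt hn⟩

/-- **Compactness of the canopy set.**
Let `E` be a complete metric space, `f i : E → E` Lipschitz with constants
`r i`, `r := max_i r i < 1`, and `x₀ ∈ E`.  With depth-`k` endpoint sets
`A_k = {compWord f w x₀ : w : Fin k → ι}`, the canopy set
`𝒞 = closure (⋃ k, A_k)` is compact. -/
theorem canopy_isCompact
    {E : Type*} [MetricSpace E] [CompleteSpace E]
    {ι : Type*} [Fintype ι] [Nonempty ι]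
    (f : ι → E → E) (r : ι → ℝ≥0) (hf : ∀ i, LipschitzWith (r i) (f i))
    (hr : (Finset.univ.sup r : ℝ≥0) < 1) (x₀ : E) :
    IsCompact
      (closure (⋃ k : ℕ, Set.range fun w : Fin k → ι => compWord f w x₀)) := by
  set R : ℝ≥0 := Finset.univ.sup r
  have hfR (i : ι) : LipschitzWith R (f i) :=
    (hf i).weaken (Finset.le_sup (Finset.mem_univ i))
  have hR : 0 < 1 - (R : ℝ) := sub_pos.mpr (NNReal.coe_lt_one.mpr hr)
  set C : ℝ := ∑ i, dist (f i x₀) x₀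
  have hC : 0 ≤ C := Finset.sum_nonneg fun i _ => dist_nonneg
  have hfM (i : ι) : R * (C / (1 - R)) + dist (f i x₀) x₀ ≤ C / (1 - R) := by
    have hi : dist (f i x₀) x₀ ≤ C :=
      Finset.single_le_sum (f := fun i => dist (f i x₀) x₀) (fun i _ => dist_nonneg)
        (Finset.mem_univ i)
    have hdiv : (1 - (R : ℝ)) * (C / (1 - R)) = C := mul_div_cancel₀ C hR.ne'
    linarith
  refine (totallyBounded_of_subset_insert_iUnion_image (M := C / (1 - R)) (x₀ := x₀)
    hr hfR ?_ ?_).closure.isCompact_of_isClosed isClosed_closure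
  · rintro _ ⟨_, ⟨k, rfl⟩, w, rfl⟩
    exact dist_compWord_le hfR (by positivity) hfM w
  · rintro _ ⟨_, ⟨k, rfl⟩, w, rfl⟩
    cases k with
    | zero => exact Or.inl rfl
    | succ k =>
      exact Or.inr (Set.mem_iUnion.mpr ⟨w 0, _,
        Set.mem_iUnion.mpr ⟨k, fun j => w j.succ, rfl⟩, rfl⟩)
end

section
/- Let E be a complete metric space, ι a nonempty finite index set, f : ι → E → E with each f i Lipschitz with constant r i, r := max over i of r i with r < 1, and x₀ ∈ E. Let 𝒜 be the attractor, i.e. the unique nonempty compact set with 𝒜 = ⋃_{i ∈ ι} (f i) '' 𝒜, and define the depth-k endpoint sets A_k := { (f (w 0) ∘ ⋯ ∘ f (w (k−1)))(x₀) : w : Fin k → ι }. Then the accumulation set of the branch endpoints equals the attractor: ⋂_{n ∈ ℕ} closure(⋃_{k ≥ n} A_k) = 𝒜. -/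
open scoped NNReal

theorem LipschitzWith.compWord {E ι : Type*} [PseudoEMetricSpace E] {f : ι → E → E} {K : ℝ≥0}
    (hf : ∀ i, LipschitzWith K (f i)) {k : ℕ} (w : Fin k → ι) :
    LipschitzWith (K ^ k) (compWord f w) := by
  induction k with
  | zero => simpa [_root_.compWord] using LipschitzWith.id
  | succ k ih =>
    rw [pow_succ']
    exact (hf (w 0)).comp (ih fun j => w j.succ)

theorem Set.MapsTo.compWord {E ι : Type*} {f : ι → E → E} {s : Set E}
    (hf : ∀ i, Set.MapsTo (f i) s s) {k : ℕ} (w : Fin k → ι) :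
    Set.MapsTo (compWord f w) s s := by
  induction k with
  | zero => exact Set.mapsTo_id s
  | succ k ih => exact (hf (w 0)).comp (ih fun j => w j.succ)

theorem exists_compWord_eq {E ι : Type*} {f : ι → E → E} {s : Set E}
    (hs : s ⊆ ⋃ i, f i '' s) (k : ℕ) {a : E} (ha : a ∈ s) :
    ∃ w : Fin k → ι, ∃ b ∈ s, compWord f w b = a := by
  induction k generalizing a with
  | zero => exact ⟨Fin.elim0, a, ha, rfl⟩
  | succ k ih =>
    obtain ⟨i, c, hc, rfl⟩ := Set.mem_iUnion.1 (hs ha)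
    obtain ⟨w, b, hb, rfl⟩ := ih hc
    exact ⟨Fin.cons i w, b, hb, by simp [compWord]⟩

/-- **Canopy set equivalence.**
Let `E` be a complete metric space, `f i : E → E` Lipschitz with constants
`r i`, `r := max_i r i < 1`, `x₀ ∈ E`, and let `𝓐` be the attractor (the
unique nonempty compact set with `𝓐 = ⋃ i, f i '' 𝓐`).  With depth-`k`
endpoint sets `A_k = {compWord f w x₀ : w : Fin k → ι}`, the accumulation set
of the branch endpoints equals the attractor:
`⋂ n, closure (⋃ k ≥ n, A_k) = 𝓐`. -/
theorem canopy_eq_attractor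
    {E : Type*} [MetricSpace E] [CompleteSpace E]
    {ι : Type*} [Fintype ι] [Nonempty ι]
    (f : ι → E → E) (r : ι → ℝ≥0) (hf : ∀ i, LipschitzWith (r i) (f i))
    (hr : (Finset.univ.sup r : ℝ≥0) < 1) (x₀ : E)
    (𝓐 : Set E) (h𝓐ne : 𝓐.Nonempty) (h𝓐c : IsCompact 𝓐)
    (h𝓐 : 𝓐 = ⋃ i, f i '' 𝓐) :
    (⋂ n : ℕ, closure
        (⋃ k : ℕ, ⋃ _ : n ≤ k, Set.range fun w : Fin k → ι => compWord f w x₀)) = 𝓐 := by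
  set R := Finset.univ.sup r
  have hfR : ∀ i, LipschitzWith R (f i) := fun i =>
    (hf i).weaken (Finset.le_sup (Finset.mem_univ i))
  have hmaps : ∀ i, Set.MapsTo (f i) 𝓐 𝓐 := fun i a ha => by
    rw [h𝓐]
    exact Set.mem_iUnion.2 ⟨i, a, ha, rfl⟩
  obtain ⟨D, hD⟩ := h𝓐c.isBounded.subset_closedBall x₀
  have hdist : ∀ {k : ℕ} (w : Fin k → ι), ∀ b ∈ 𝓐,
      dist (compWord f w b) (compWord f w x₀) ≤ (R : ℝ) ^ k * D := fun {k} w b hb => by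
    have h := (LipschitzWith.compWord hfR w).dist_le_mul b x₀
    rw [NNReal.coe_pow] at h
    exact h.trans (mul_le_mul_of_nonneg_left (hD hb) (by positivity))
  obtain ⟨b₀, hb₀⟩ := h𝓐ne
  have hD0 : 0 ≤ D := dist_nonneg.trans (hD hb₀)
  have hlim : Filter.Tendsto (fun k : ℕ => (R : ℝ) ^ k * D) Filter.atTop (nhds 0) := by
    simpa using (tendsto_pow_atTop_nhds_zero_of_lt_one R.coe_nonneg
      (NNReal.coe_lt_one.2 hr)).mul_const D
  have hsmall : ∀ ε > 0, ∃ N : ℕ, ∀ k ≥ N, (R : ℝ) ^ k * D < ε := fun ε hε =>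
    Filter.eventually_atTop.1 (hlim.eventually_lt_const hε)
  apply Set.Subset.antisymm
  · intro x hx
    rw [← h𝓐c.isClosed.closure_eq, Metric.mem_closure_iff]
    intro ε hε
    obtain ⟨N, hN⟩ := hsmall (ε / 2) (half_pos hε)
    obtain ⟨y, hy, hxy⟩ := Metric.mem_closure_iff.1 (Set.mem_iInter.1 hx N) (ε / 2) (half_pos hε)
    simp only [Set.mem_iUnion, Set.mem_range] at hy
    obtain ⟨k, hk, w, rfl⟩ := hy
    refine ⟨compWord f w b₀, Set.MapsTo.compWord hmaps w hb₀, ?_⟩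
    have := dist_triangle_right x (compWord f w b₀) (compWord f w x₀)
    linarith [hdist w b₀ hb₀, hN k hk]
  · intro a ha
    refine Set.mem_iInter.2 fun n => Metric.mem_closure_iff.2 fun ε hε => ?_
    obtain ⟨N, hN⟩ := hsmall ε hε
    obtain ⟨w, b, hb, rfl⟩ := exists_compWord_eq h𝓐.subset (max n N) ha
    refine ⟨compWord f w x₀, ?_, (hdist w b hb).trans_lt (hN _ (le_max_right n N))⟩
    simp only [Set.mem_iUnion, Set.mem_range]
    exact ⟨_, le_max_left n N, w, rfl⟩
end
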